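/- arXiv:2004.10846 — 2 statements merged into one kernel-verified Lean document; each statement's English description precedes it below -/
import Mathlib

section
/- Assume p < 1 − β^α and p < 1/2, and let ĉ satisfy c₀ ≤ ĉ < 1 where c₀ = (1−p)(1−β^α)/(2−p−β^α−p·β^α+p·β^{2α}). Set Z₂* = ((1−p)(1−ĉ)/(p·β^α+β^{−α}−2p))^{−1/α} and Z₁* = ((1−p)(1−ĉ)/(p·β^α+β^{−α}−2p) + ĉ)^{−1/α}. Then 1 ≤ Z₁* < Z₂*, σ([Z₁*,Z₂*]) = (1/2)·(1−p)(1−β^α)·(β^{−α}−p)·(1−ĉ)²/(p·β^α+β^{−α}−2p), and for every interval [Z₁,Z₂] with 1 ≤ Z₁ < Z₂ and Z₁^{−α} − Z₂^{−α} ≤ ĉ one has σ([Z₁,Z₂]) ≥ σ([Z₁*,Z₂*]). -/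
open MeasureTheory

open Set

/-- Tail function `F̄(t) = min(1, t^{-α})`. -/
noncomputable def Fbar (α t : ℝ) : ℝ := min 1 (t ^ (-α))

/-- Biased school assignment of a G₂ student of true potential `z`. -/
noncomputable def muHat2 (α β p z : ℝ) : ℝ :=
  (1 - p) * Fbar α (β * z) + p * z ^ (-α)

/-- School attended by a G₂ student of true potential `z` after the G₂ students
with true potentials in `[Z₁, Z₂]` have been debiased. -/
noncomputable def muT (α β p Z₁ Z₂ z : ℝ) : ℝ :=
  if z < Z₁ then (1 - p) * Fbar α (β * z) + p * z ^ (-α)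
  else if z ≤ Z₂ then
    (1 - p) * z ^ (-α) + p * (z ^ (-α) - Z₂ ^ (-α)) + p * (max (z / β) Z₂) ^ (-α)
  else
    (1 - p) * Fbar α (β * z) + p * z ^ (-α)
      + p * max 0 ((max (β * z) Z₁) ^ (-α) - Z₂ ^ (-α))

/-- Positive area under the curve (average mistreatment of G₂ students) after
debiasing `[Z₁, Z₂]`. -/
noncomputable def pauc (α β p Z₁ Z₂ : ℝ) : ℝ :=
  ∫ z in Ioi (1:ℝ), max (muT α β p Z₁ Z₂ z - z ^ (-α)) 0 * (α * z ^ (-α - 1))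

/-- Half the squared positive part. -/
noncomputable def halfSqPos (x : ℝ) : ℝ := max x 0 ^ 2 / 2

theorem halfSqPos_of_nonneg {x : ℝ} (hx : 0 ≤ x) : halfSqPos x = x ^ 2 / 2 := by
  rw [halfSqPos, max_eq_left hx]

theorem halfSqPos_of_nonpos {x : ℝ} (hx : x ≤ 0) : halfSqPos x = 0 := by
  rw [halfSqPos, max_eq_right hx]; simp

theorem halfSqPos_sub_le {x y z : ℝ} (hxy : y ≤ x) (hxz : x ≤ z) (hz : 0 ≤ z) :
    halfSqPos x - halfSqPos y ≤ (x - y) * z := by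
  rcases le_total x 0 with hx | hx
  · rw [halfSqPos_of_nonpos hx, halfSqPos_of_nonpos (hxy.trans hx)]
    nlinarith
  · rw [halfSqPos_of_nonneg hx]
    rcases le_total y 0 with hy | hy
    · rw [halfSqPos_of_nonpos hy]; nlinarith
    · rw [halfSqPos_of_nonneg hy]; nlinarith

/-- Antiderivative of `u ↦ min 1 (u / b) - u` on `[0, ∞)`. -/
noncomputable def biasGapPrimitive (b t : ℝ) : ℝ :=
  t ^ 2 / (2 * b) - t ^ 2 / 2 - b * halfSqPos (t / b - 1)

/-- The positive area under the curve in terms of the ranks `a = Z₁ ^ (-α)`, `d = Z₂ ^ (-α)` of the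
endpoints of the debiased interval and of `b = β ^ α`. -/
noncomputable def rankPauc (b p a d : ℝ) : ℝ :=
  (1 - p) * (biasGapPrimitive b 1 - biasGapPrimitive b a + biasGapPrimitive b d)
    + p * (d ^ 2 * (1 - b) ^ 2 / (2 * b) - b * halfSqPos (d / b - a))

theorem biasGapPrimitive_of_le {b t : ℝ} (hb : 0 < b) (ht : t ≤ b) :
    biasGapPrimitive b t = t ^ 2 * (1 - b) / (2 * b) := by
  rw [biasGapPrimitive, halfSqPos_of_nonpos (by rw [sub_nonpos, div_le_one hb]; exact ht)]
  field_simp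
  ring

theorem biasGapPrimitive_of_ge {b t : ℝ} (hb : 0 < b) (ht : b ≤ t) :
    biasGapPrimitive b t = (1 - b) / 2 - (1 - t) ^ 2 / 2 := by
  rw [biasGapPrimitive, halfSqPos_of_nonneg (by rw [sub_nonneg, one_le_div hb]; exact ht)]
  field_simp
  ring

section

variable {b p a d c : ℝ}

theorem mul_halfSqPos_of_mul_le (hb : 0 < b) (h : a * b ≤ d) :
    b * halfSqPos (d / b - a) = (d - a * b) ^ 2 / (2 * b) := by
  rw [halfSqPos_of_nonneg (by rw [sub_nonneg, le_div_iff₀ hb]; exact h)]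
  field_simp

theorem halfSqPos_of_le_mul (hb : 0 < b) (h : d ≤ a * b) : halfSqPos (d / b - a) = 0 :=
  halfSqPos_of_nonpos (by rw [sub_nonpos, div_le_iff₀ hb]; exact h)

theorem rankPauc_of_le_mul (hb : 0 < b) (hb1 : b ≤ 1) (ha : b ≤ a) (hdb : d ≤ b)
    (hda : d ≤ a * b) :
    rankPauc b p a d = (1 - p) * (d ^ 2 * (1 - b) / (2 * b) + (1 - a) ^ 2 / 2)
      + p * (d ^ 2 * (1 - b) ^ 2 / (2 * b)) := by
  rw [rankPauc, biasGapPrimitive_of_ge hb hb1, biasGapPrimitive_of_ge hb ha,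
    biasGapPrimitive_of_le hb hdb, halfSqPos_of_le_mul hb hda]
  ring

theorem rankPauc_of_mul_le (hb : 0 < b) (hb1 : b ≤ 1) (ha : b ≤ a) (hdb : d ≤ b)
    (hda : a * b ≤ d) :
    rankPauc b p a d = (1 - p) * (d ^ 2 * (1 - b) / (2 * b) + (1 - a) ^ 2 / 2)
      + p * ((a - d) * d * (1 - b) - b * (a - d) ^ 2 / 2) := by
  rw [rankPauc, biasGapPrimitive_of_ge hb hb1, biasGapPrimitive_of_ge hb ha,
    biasGapPrimitive_of_le hb hdb, mul_halfSqPos_of_mul_le hb hda]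
  field_simp
  ring

/-- Shifting the interval down to `d = b` does not increase the area. -/
theorem rankPauc_shift_le (hb : 0 < b) (hb1 : b < 1) (hp : 0 < p) (hp1 : p < 1 / 2)
    (hbd : b ≤ d) (hda : d ≤ a) (ha : a ≤ 1) :
    rankPauc b p (a - d + b) b ≤ rankPauc b p a d := by
  rw [rankPauc_of_mul_le hb hb1.le (by linarith) le_rfl (by nlinarith), rankPauc,
    biasGapPrimitive_of_ge hb hb1.le, biasGapPrimitive_of_ge hb (hbd.trans hda),
    biasGapPrimitive_of_ge hb hbd, mul_halfSqPos_of_mul_le hb (by nlinarith)]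
  have key : (1 - p) * ((1 - b) / 2 - (1 - 1) ^ 2 / 2 - ((1 - b) / 2 - (1 - a) ^ 2 / 2)
      + ((1 - b) / 2 - (1 - d) ^ 2 / 2))
      + p * (d ^ 2 * (1 - b) ^ 2 / (2 * b) - (d - a * b) ^ 2 / (2 * b))
      - ((1 - p) * (b ^ 2 * (1 - b) / (2 * b) + (1 - (a - d + b)) ^ 2 / 2)
      + p * ((a - d + b - b) * b * (1 - b) - b * (a - d + b - b) ^ 2 / 2))
      = (a - d) * (d - b) * ((1 - p) + p * (1 - b)) := by
    field_simp
    ring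
  have : 0 ≤ (a - d) * (d - b) * ((1 - p) + p * (1 - b)) :=
    mul_nonneg (mul_nonneg (by linarith) (by linarith)) (by nlinarith)
  linarith

/-- Below `b`, enlarging the rank `a` does not increase the area. -/
theorem rankPauc_enlarge_upper_le (hb : 0 < b) (hb1 : b < 1) (hp : 0 < p) (hp1 : p < 1 / 2)
    {a' : ℝ} (ha : 0 ≤ a) (hda : d ≤ a) (haa : a ≤ a') (hab : a' ≤ b) :
    rankPauc b p a' d ≤ rankPauc b p a d := by
  have h := halfSqPos_sub_le (x := d / b - a) (y := d / b - a') (z := a / b - a) (by linarith)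
    (by gcongr) (by rw [sub_nonneg, le_div_iff₀ hb]; nlinarith)
  rw [rankPauc, rankPauc, biasGapPrimitive_of_le hb hab, biasGapPrimitive_of_le hb (haa.trans hab)]
  have h1 : p * (b * (halfSqPos (d / b - a) - halfSqPos (d / b - a')))
      ≤ p * (b * ((a' - a) * (a / b - a))) := by
    refine mul_le_mul_of_nonneg_left (mul_le_mul_of_nonneg_left (h.trans_eq (by ring)) hb.le) hp.le
  have h2 : (1 - p) * (a' ^ 2 * (1 - b) / (2 * b) - a ^ 2 * (1 - b) / (2 * b))
      - p * (b * ((a' - a) * (a / b - a)))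
      = (1 - b) * (a' - a) * ((1 - p) * (a' + a) - 2 * p * b * a) / (2 * b) := by
    field_simp
    ring
  have h3 : 0 ≤ (1 - b) * (a' - a) * ((1 - p) * (a' + a) - 2 * p * b * a) / (2 * b) := by
    have : 0 ≤ (1 - p) * (a' + a) - 2 * p * b * a := by
      have : p * b ≤ 1 - p := by nlinarith
      nlinarith
    exact div_nonneg (mul_nonneg (mul_nonneg (by linarith) (by linarith)) this) (by linarith)
  linarith

/-- Below `b`, shifting the interval up to `a = b` does not increase the area, as long as the length
is at least `b * (1 - b)`. -/
theorem rankPauc_shift_up_le (hb : 0 < b) (hb1 : b < 1) (hp : 0 < p) (hp1 : p < 1 / 2)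
    (hc : b * (1 - b) ≤ c) (hd : 0 ≤ d) (hdc : d + c ≤ b) :
    rankPauc b p b (b - c) ≤ rankPauc b p (d + c) d := by
  have hc0 : 0 ≤ c := le_trans (mul_nonneg hb.le (by linarith)) hc
  rw [rankPauc, rankPauc, biasGapPrimitive_of_le hb le_rfl, biasGapPrimitive_of_le hb hdc,
    biasGapPrimitive_of_le hb (t := d) (by linarith),
    biasGapPrimitive_of_le hb (t := b - c) (by linarith),
    halfSqPos_of_le_mul hb (by nlinarith), halfSqPos_of_le_mul hb (by nlinarith)]
  have key : (1 - p) * (biasGapPrimitive b 1 - (d + c) ^ 2 * (1 - b) / (2 * b)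
        + d ^ 2 * (1 - b) / (2 * b))
      + p * (d ^ 2 * (1 - b) ^ 2 / (2 * b) - b * 0)
      - ((1 - p) * (biasGapPrimitive b 1 - b ^ 2 * (1 - b) / (2 * b)
        + (b - c) ^ 2 * (1 - b) / (2 * b))
      + p * ((b - c) ^ 2 * (1 - b) ^ 2 / (2 * b) - b * 0))
      = (1 - b) * (b - c - d) * ((1 - p) * (2 * c) - p * (1 - b) * (b - c + d)) / (2 * b) := by
    field_simp
    ring
  have h1 : 0 ≤ (1 - p) * (2 * c) - p * (1 - b) * (b - c + d) := by
    have : (1 - b) * (b - c + d) ≤ 2 * c := by nlinarith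
    nlinarith
  have h2 := div_nonneg (mul_nonneg (mul_nonneg (sub_nonneg.2 hb1.le)
    (show 0 ≤ b - c - d by linarith)) h1) (show 0 ≤ 2 * b by linarith)
  linarith

/-- If `a * b ≤ d`, lowering the rank `d` does not increase the area. -/
theorem rankPauc_enlarge_lower_le (hb : 0 < b) (hb1 : b < 1) (hp : 0 < p) (hp1 : p < 1 / 2)
    {d' : ℝ} (ha : b ≤ a) (hda : d ≤ a) (hdb : d ≤ b) (hd' : a * b ≤ d') (hdd : d' ≤ d) :
    rankPauc b p a d' ≤ rankPauc b p a d := by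
  rw [rankPauc_of_mul_le hb hb1.le ha (hdd.trans hdb) hd',
    rankPauc_of_mul_le hb hb1.le ha hdb (hd'.trans hdd)]
  have key : (1 - p) * (d ^ 2 * (1 - b) / (2 * b) + (1 - a) ^ 2 / 2)
      + p * ((a - d) * d * (1 - b) - b * (a - d) ^ 2 / 2)
      - ((1 - p) * (d' ^ 2 * (1 - b) / (2 * b) + (1 - a) ^ 2 / 2)
      + p * ((a - d') * d' * (1 - b) - b * (a - d') ^ 2 / 2))
      = (d - d') * ((1 - b) * (d + d') * ((1 - p) - p * b)
        + p * b * (2 * a - d - d')) / (2 * b) := by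
    field_simp
    ring
  have hd0 : 0 ≤ d' := le_trans (mul_nonneg (hb.le.trans ha) hb.le) hd'
  have h1 : 0 ≤ (1 - p) - p * b := by nlinarith
  have h2 := div_nonneg (mul_nonneg (sub_nonneg.2 hdd) (add_nonneg (mul_nonneg (mul_nonneg
    (sub_nonneg.2 hb1.le) (show 0 ≤ d + d' by linarith)) h1) (mul_nonneg (mul_nonneg hp.le hb.le)
    (show 0 ≤ 2 * a - d - d' by linarith)))) (show 0 ≤ 2 * b by linarith)
  linarith

/-- Shifting an interval of length `c` down to the ray `d = a * b` does not increase the area. -/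
theorem rankPauc_shift_to_ray_le (hb : 0 < b) (hb1 : b < 1) (hp : 0 < p) (hp1 : p < 1 / 2)
    (hc : (1 - p) * (1 - b) ≤ c * (2 - p - b - p * b + p * b ^ 2)) (hcb : b * (1 - b) ≤ c)
    (ha : c ≤ a * (1 - b)) (hac : a - c ≤ b) :
    rankPauc b p (c / (1 - b)) (c / (1 - b) * b) ≤ rankPauc b p a (a - c) := by
  obtain ⟨x, rfl⟩ : ∃ x, c = x * (1 - b) := ⟨c / (1 - b), by field_simp [(sub_pos.2 hb1).ne']⟩
  have h1b : 0 < 1 - b := sub_pos.2 hb1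
  rw [mul_div_cancel_right₀ _ h1b.ne']
  have hbx : b ≤ x := le_of_mul_le_mul_right hcb h1b
  have hxa : x ≤ a := le_of_mul_le_mul_right ha h1b
  have hx : 1 - p ≤ x * (2 - p - b - p * b + p * b ^ 2) :=
    le_of_mul_le_mul_right (by linarith) h1b
  rw [rankPauc_of_mul_le hb hb1.le hbx (by nlinarith) le_rfl,
    rankPauc_of_mul_le hb hb1.le (hbx.trans hxa) hac (by nlinarith)]
  have key : (1 - p) * ((a - x * (1 - b)) ^ 2 * (1 - b) / (2 * b) + (1 - a) ^ 2 / 2)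
      + p * ((a - (a - x * (1 - b))) * (a - x * (1 - b)) * (1 - b)
        - b * (a - (a - x * (1 - b))) ^ 2 / 2)
      - ((1 - p) * ((x * b) ^ 2 * (1 - b) / (2 * b) + (1 - x) ^ 2 / 2)
      + p * ((x - x * b) * (x * b) * (1 - b) - b * (x - x * b) ^ 2 / 2))
      = (a - x) * (x * (2 - p - b - p * b + p * b ^ 2) - (1 - p))
        + (1 - p) * (a - x) ^ 2 / (2 * b) := by
    field_simp
    ring
  have h1 := mul_nonneg (sub_nonneg.2 hxa) (sub_nonneg.2 hx)
  have h2 : 0 ≤ (1 - p) * (a - x) ^ 2 / (2 * b) :=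
    div_nonneg (mul_nonneg (by linarith) (sq_nonneg _)) (by linarith)
  linarith

theorem mul_one_sub_le_of_budget (hb : 0 < b) (hb1 : b < 1) (hp : 0 < p) (hpb : p < 1 - b)
    (hc : (1 - p) * (1 - b) ≤ c * (2 - p - b - p * b + p * b ^ 2)) : b * (1 - b) ≤ c := by
  have hD : 0 < 2 - p - b - p * b + p * b ^ 2 := by nlinarith [mul_pos hp hb, mul_pos hb hb]
  refine le_of_mul_le_mul_right (le_trans ?_ hc) hD
  have h : b * (2 - p - b - p * b + p * b ^ 2) ≤ 1 - p := by
    have e : 1 - p - b * (2 - p - b - p * b + p * b ^ 2)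
        = (1 - b - p) * ((1 - b) * (1 - b ^ 2)) + b ^ 2 * (1 - b) ^ 2 := by ring
    have : 0 ≤ (1 - b - p) * ((1 - b) * (1 - b ^ 2)) :=
      mul_nonneg (by linarith) (mul_nonneg (by linarith) (by nlinarith))
    nlinarith [sq_nonneg (b * (1 - b))]
  nlinarith

/-- The area is minimized in the region `b ≤ a`, `d ≤ a * b`. -/
theorem exists_rankPauc_le (hb : 0 < b) (hb1 : b < 1) (hp : 0 < p) (hp1 : p < 1 / 2)
    (hpb : p < 1 - b) (hc : (1 - p) * (1 - b) ≤ c * (2 - p - b - p * b + p * b ^ 2))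
    (hd : 0 ≤ d) (hda : d ≤ a) (ha : a ≤ 1) (hac : a - d ≤ c) :
    ∃ a' d', b ≤ a' ∧ a' ≤ 1 ∧ d' ≤ b ∧ d' ≤ a' * b ∧ a' - d' ≤ c ∧
      rankPauc b p a' d' ≤ rankPauc b p a d := by
  have hcb := mul_one_sub_le_of_budget hb hb1 hp hpb hc
  have h1b : 0 < 1 - b := sub_pos.2 hb1
  have mid : ∀ a d : ℝ, b ≤ a → a ≤ 1 → d ≤ a → d ≤ b → a - d ≤ c →
      ∃ a' d', b ≤ a' ∧ a' ≤ 1 ∧ d' ≤ b ∧ d' ≤ a' * b ∧ a' - d' ≤ c ∧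
        rankPauc b p a' d' ≤ rankPauc b p a d := by
    intro a d hba ha1 hda hdb hac
    rcases le_total d (a * b) with h | h
    · exact ⟨a, d, hba, ha1, hdb, h, hac, le_rfl⟩
    rcases le_total (a * (1 - b)) c with h' | h'
    · exact ⟨a, a * b, hba, ha1, by nlinarith, le_rfl, by linarith,
        rankPauc_enlarge_lower_le hb hb1 hp hp1 hba hda hdb le_rfl h⟩
    · have hx : c / (1 - b) ≤ a := by rwa [div_le_iff₀ h1b]
      refine ⟨c / (1 - b), c / (1 - b) * b, by rwa [le_div_iff₀ h1b], hx.trans ha1, by nlinarith,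
        le_rfl, ?_, (rankPauc_shift_to_ray_le hb hb1 hp hp1 hc hcb h' (by linarith)).trans
        (rankPauc_enlarge_lower_le hb hb1 hp hp1 hba hda hdb (by linarith) (by linarith))⟩
      exact le_of_eq (by field_simp)
  rcases le_total b d with hbd | hdb
  · obtain ⟨a', d', h1, h2, h3, h4, h5, h6⟩ :=
      mid (a - d + b) b (by linarith) (by linarith) (by linarith) le_rfl (by linarith)
    exact ⟨a', d', h1, h2, h3, h4, h5, h6.trans (rankPauc_shift_le hb hb1 hp hp1 hbd hda ha)⟩
  rcases le_total b a with hba | hab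
  · exact mid a d hba ha hda hdb hac
  rcases le_total b (d + c) with h | h
  · obtain ⟨a', d', h1, h2, h3, h4, h5, h6⟩ := mid b d le_rfl hb1.le hdb hdb (by linarith)
    exact ⟨a', d', h1, h2, h3, h4, h5,
      h6.trans (rankPauc_enlarge_upper_le hb hb1 hp hp1 (hd.trans hda) hda hab le_rfl)⟩
  · exact ⟨b, b - c, le_rfl, hb1.le, by nlinarith, by nlinarith, by linarith,
      (rankPauc_shift_up_le hb hb1 hp hp1 hcb hd h).trans
      (rankPauc_enlarge_upper_le hb hb1 hp hp1 (hd.trans hda) hda (by linarith) h)⟩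

end

section Optimum

variable {b p c : ℝ}

theorem optimum_denom_pos (hb : 0 < b) (hb1 : b < 1) (hp : 0 < p) (hp1 : p < 1 / 2) :
    0 < p * b + b⁻¹ - 2 * p := by
  have := (one_lt_inv₀ hb).2 hb1
  nlinarith [mul_pos hp hb]

theorem optimum_upper_le_one (hb : 0 < b) (hb1 : b < 1) (hp : 0 < p) (hp1 : p < 1 / 2)
    (hc1 : c < 1) : (1 - p) * (1 - c) / (p * b + b⁻¹ - 2 * p) + c ≤ 1 := by
  have h : (1 - p) * (1 - c) / (p * b + b⁻¹ - 2 * p) ≤ 1 - c := by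
    rw [div_le_iff₀ (optimum_denom_pos hb hb1 hp hp1), mul_comm]
    refine mul_le_mul_of_nonneg_left ?_ (by linarith)
    have : 1 + (1 - b) ≤ b⁻¹ := by
      rw [← one_div, le_div_iff₀ hb]; nlinarith [sq_nonneg (1 - b)]
    nlinarith
  linarith

theorem le_optimum_upper (hb : 0 < b) (hb1 : b < 1) (hp : 0 < p) (hp1 : p < 1 / 2)
    (hpb : p < 1 - b) (hc : (1 - p) * (1 - b) ≤ c * (2 - p - b - p * b + p * b ^ 2)) :
    b ≤ (1 - p) * (1 - c) / (p * b + b⁻¹ - 2 * p) + c := by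
  have hcb := mul_one_sub_le_of_budget hb hb1 hp hpb hc
  have hD := optimum_denom_pos hb hb1 hp hp1
  have hinv : 1 + (1 - b) ≤ b⁻¹ := by
    rw [← one_div, le_div_iff₀ hb]; nlinarith [sq_nonneg (1 - b)]
  have h0 : b * b⁻¹ = 1 := mul_inv_cancel₀ hb.ne'
  rw [← sub_le_iff_le_add, le_div_iff₀ hD]
  have e : (1 - p) * (1 - c) - (b - c) * (p * b + b⁻¹ - 2 * p)
      = (c - b * (1 - b)) * (p * b + b⁻¹ - 2 * p - (1 - p)) + (1 - b) ^ 2 * (1 - p * (1 + b)) := by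
    linear_combination (-b) * h0
  have h1 : 0 ≤ (c - b * (1 - b)) * (p * b + b⁻¹ - 2 * p - (1 - p)) :=
    mul_nonneg (by linarith) (by nlinarith)
  have h2 : 0 ≤ (1 - b) ^ 2 * (1 - p * (1 + b)) := mul_nonneg (sq_nonneg _) (by nlinarith)
  linarith

theorem optimum_lower_le_mul (hb : 0 < b) (hb1 : b < 1) (hp : 0 < p) (hp1 : p < 1 / 2)
    (hc : (1 - p) * (1 - b) ≤ c * (2 - p - b - p * b + p * b ^ 2)) :
    (1 - p) * (1 - c) / (p * b + b⁻¹ - 2 * p)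
      ≤ ((1 - p) * (1 - c) / (p * b + b⁻¹ - 2 * p) + c) * b := by
  have hD := optimum_denom_pos hb hb1 hp hp1
  have h0 : b * b⁻¹ = 1 := mul_inv_cancel₀ hb.ne'
  have h : (1 - p) * (1 - c) / (p * b + b⁻¹ - 2 * p) * (1 - b) ≤ c * b := by
    rw [div_mul_eq_mul_div, div_le_iff₀ hD]
    have e : c * b * (p * b + b⁻¹ - 2 * p) - (1 - p) * (1 - c) * (1 - b)
        = c * (2 - p - b - p * b + p * b ^ 2) - (1 - p) * (1 - b) := by
      linear_combination c * h0
    linarith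
  linarith

theorem rankPauc_mul_denom {x y : ℝ} (hb : b ≠ 0) :
    ((1 - p) * (y ^ 2 * (1 - b) / (2 * b) + (1 - x) ^ 2 / 2)
      + p * (y ^ 2 * (1 - b) ^ 2 / (2 * b))) * (p * b + b⁻¹ - 2 * p)
      = (1 - p) * ((1 - b) * (b⁻¹ - p)) * (y + (1 - x)) ^ 2 / 2
        + ((1 - b) * (b⁻¹ - p) * y - (1 - p) * (1 - x)) ^ 2 / 2 := by
  field_simp
  ring

theorem rankPauc_optimum (hb : 0 < b) (hb1 : b < 1) (hp : 0 < p) (hp1 : p < 1 / 2)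
    (hpb : p < 1 - b) (hc : (1 - p) * (1 - b) ≤ c * (2 - p - b - p * b + p * b ^ 2))
    (hc1 : c < 1) :
    rankPauc b p ((1 - p) * (1 - c) / (p * b + b⁻¹ - 2 * p) + c)
        ((1 - p) * (1 - c) / (p * b + b⁻¹ - 2 * p))
      = (1 / 2) * ((1 - p) * (1 - b)) * ((b⁻¹ - p) * (1 - c) ^ 2) / (p * b + b⁻¹ - 2 * p) := by
  have hda := optimum_lower_le_mul hb hb1 hp hp1 hc
  have ha := optimum_upper_le_one hb hb1 hp hp1 hc1
  have hD := (optimum_denom_pos hb hb1 hp hp1).ne'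
  rw [rankPauc_of_le_mul hb hb1.le (le_optimum_upper hb hb1 hp hp1 hpb hc)
    (by nlinarith) hda, eq_div_iff hD, rankPauc_mul_denom hb.ne']
  have h := div_mul_cancel₀ ((1 - p) * (1 - c)) hD
  set d := (1 - p) * (1 - c) / (p * b + b⁻¹ - 2 * p)
  have h0 : (1 - b) * (b⁻¹ - p) * d - (1 - p) * (1 - (d + c)) = 0 := by
    linear_combination h - d * mul_inv_cancel₀ hb.ne'
  rw [h0]
  ring

theorem optimum_le_rankPauc {a d : ℝ} (hb : 0 < b) (hb1 : b < 1) (hp : 0 < p) (hp1 : p < 1 / 2)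
    (hpb : p < 1 - b) (hc : (1 - p) * (1 - b) ≤ c * (2 - p - b - p * b + p * b ^ 2))
    (hc1 : c < 1) (hd : 0 ≤ d) (hda : d ≤ a) (ha : a ≤ 1) (hac : a - d ≤ c) :
    (1 / 2) * ((1 - p) * (1 - b)) * ((b⁻¹ - p) * (1 - c) ^ 2) / (p * b + b⁻¹ - 2 * p)
      ≤ rankPauc b p a d := by
  obtain ⟨x, y, h1, h2, h3, h4, h5, h6⟩ := exists_rankPauc_le hb hb1 hp hp1 hpb hc hd hda ha hac
  refine le_trans ?_ h6
  rw [rankPauc_of_le_mul hb hb1.le h1 h3 h4, div_le_iff₀ (optimum_denom_pos hb hb1 hp hp1),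
    rankPauc_mul_denom hb.ne']
  have hinv := (one_lt_inv₀ hb).2 hb1
  have h0 : 0 ≤ (1 - p) * ((1 - b) * (b⁻¹ - p)) :=
    mul_nonneg (by linarith) (mul_nonneg (by linarith) (by linarith))
  have hsq : (1 - c) ^ 2 ≤ (y + (1 - x)) ^ 2 := by
    apply pow_le_pow_left₀ <;> linarith
  nlinarith [mul_le_mul_of_nonneg_left hsq h0,
    sq_nonneg ((1 - b) * (b⁻¹ - p) * y - (1 - p) * (1 - x))]

end Optimum

theorem hasDerivAt_halfSqPos (x : ℝ) : HasDerivAt halfSqPos (max x 0) x := by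
  rcases lt_trichotomy x 0 with hx | rfl | hx
  · rw [max_eq_right hx.le]
    refine (hasDerivAt_const x (0 : ℝ)).congr_of_eventuallyEq ?_
    filter_upwards [Iio_mem_nhds hx] with y hy using halfSqPos_of_nonpos (le_of_lt hy)
  · rw [max_self, hasDerivAt_iff_isLittleO]
    have h : (fun x : ℝ => x ^ 2) =o[nhds 0] fun x => x :=
      Asymptotics.isLittleO_pow_id one_lt_two
    refine (Asymptotics.IsBigO.of_bound 1 (Filter.Eventually.of_forall fun y => ?_)).trans_isLittleO
      (h.congr_right fun y => (sub_zero y).symm)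
    rw [halfSqPos_of_nonneg le_rfl]
    rcases le_total 0 y with hy | hy
    · rw [halfSqPos_of_nonneg hy]
      simp [sq_nonneg]
    · rw [halfSqPos_of_nonpos hy]
      simp [sq_nonneg]
  · rw [max_eq_left hx.le]
    have h : HasDerivAt (fun y : ℝ => y ^ 2 / 2) x x := by
      simpa using (hasDerivAt_pow 2 x).div_const 2
    refine h.congr_of_eventuallyEq ?_
    filter_upwards [Ioi_mem_nhds hx] with y hy using halfSqPos_of_nonneg (le_of_lt hy)

theorem hasDerivAt_mul_halfSqPos {b : ℝ} (hb : b ≠ 0) (s u : ℝ) :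
    HasDerivAt (fun u => b * halfSqPos (u / b - s)) (max (u / b - s) 0) u := by
  have h := ((hasDerivAt_halfSqPos (u / b - s)).comp u
    (((hasDerivAt_id u).div_const b).sub_const s)).const_mul b
  refine h.congr_deriv ?_
  field_simp

theorem hasDerivAt_biasGapPrimitive {b : ℝ} (hb : b ≠ 0) (u : ℝ) :
    HasDerivAt (biasGapPrimitive b) (min 1 (u / b) - u) u := by
  have h := ((((hasDerivAt_pow 2 u).div_const (2 * b)).sub
    ((hasDerivAt_pow 2 u).div_const 2)).sub (hasDerivAt_mul_halfSqPos hb 1 u))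
  refine h.congr_deriv ?_
  have : min 1 (u / b) = u / b - max (u / b - 1) 0 := by
    rcases le_total (u / b) 1 with h | h
    · rw [min_eq_right h, max_eq_right (by linarith)]; ring
    · rw [min_eq_left h, max_eq_left (by linarith)]; ring
  rw [this]
  push_cast
  field_simp
  ring

/-- The mistreatment of a student of rank `u`, where `a` and `d` are the ranks of the endpoints of
the debiased interval. -/
noncomputable def rankMistreatment (b p a d u : ℝ) : ℝ :=
  if a < u then (1 - p) * (min 1 (u / b) - u)
  else if d ≤ u then 0
  else (1 - p) * (min 1 (u / b) - u) + p * max 0 (min (u / b) a - d)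

theorem integral_rankMistreatment {b p a d : ℝ} (hb : 0 < b) (hb1 : b ≤ 1) (hd : 0 ≤ d)
    (hda : d ≤ a) (ha : a ≤ 1) :
    ∫ u in (0:ℝ)..1, rankMistreatment b p a d u = rankPauc b p a d := by
  let f₁ : ℝ → ℝ := fun u => (1 - p) * (min 1 (u / b) - u)
    + p * (max (u / b - d) 0 - max (u / b - a) 0)
  let f₃ : ℝ → ℝ := fun u => (1 - p) * (min 1 (u / b) - u)
  have hf₁ : Continuous f₁ := by fun_prop
  have hf₃ : Continuous f₃ := by fun_prop
  have e₁ : EqOn f₁ (rankMistreatment b p a d) (uIoo 0 d) := by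
    intro u hu
    rw [uIoo_of_le hd] at hu
    simp only [f₁, rankMistreatment]
    rw [if_neg (by linarith [hu.2]), if_neg (by linarith [hu.2])]
    congr 2
    rcases le_total (u / b) a with h | h
    · rw [min_eq_left h, max_eq_right (a := u / b - a) (by linarith), sub_zero, max_comm]
    · rw [min_eq_right h, max_eq_left (by linarith), max_eq_left (by linarith),
        max_eq_right (by linarith)]
      ring
  have e₂ : EqOn (fun _ => (0:ℝ)) (rankMistreatment b p a d) (uIoo d a) := by
    intro u hu
    rw [uIoo_of_le hda] at hu
    simp only [rankMistreatment]
    rw [if_neg (by linarith [hu.2]), if_pos hu.1.le]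
  have e₃ : EqOn f₃ (rankMistreatment b p a d) (uIoo a 1) := by
    intro u hu
    rw [uIoo_of_le ha] at hu
    simp only [rankMistreatment, f₃]
    rw [if_pos hu.1]
  have i₁ := (hf₁.intervalIntegrable (μ := volume) 0 d).congr_uIoo e₁
  have i₂ := ((continuous_const (y := (0:ℝ))).intervalIntegrable (μ := volume) d a).congr_uIoo e₂
  have i₃ := (hf₃.intervalIntegrable (μ := volume) a 1).congr_uIoo e₃
  rw [← intervalIntegral.integral_add_adjacent_intervals (i₁.trans i₂) i₃,
    ← intervalIntegral.integral_add_adjacent_intervals i₁ i₂,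
    ← intervalIntegral.integral_congr_uIoo e₁, ← intervalIntegral.integral_congr_uIoo e₂,
    ← intervalIntegral.integral_congr_uIoo e₃,
    intervalIntegral.integral_eq_sub_of_hasDerivAt (fun u _ =>
      ((hasDerivAt_biasGapPrimitive hb.ne' u).const_mul (1 - p)).add
        (((hasDerivAt_mul_halfSqPos hb.ne' d u).sub
          (hasDerivAt_mul_halfSqPos hb.ne' a u)).const_mul p)) (hf₁.intervalIntegrable 0 d),
    intervalIntegral.integral_eq_sub_of_hasDerivAt (fun u _ =>
      (hasDerivAt_biasGapPrimitive hb.ne' u).const_mul (1 - p)) (hf₃.intervalIntegrable a 1),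
    intervalIntegral.integral_zero]
  simp only [Pi.add_apply, Pi.sub_apply]
  rw [biasGapPrimitive_of_le hb hb.le, halfSqPos_of_nonneg (x := d / b - d)
      (by rw [sub_nonneg, le_div_iff₀ hb]; nlinarith),
    halfSqPos_of_nonpos (x := 0 / b - d) (by simpa using hd),
    halfSqPos_of_nonpos (x := 0 / b - a) (by simpa using hd.trans hda), rankPauc]
  field_simp
  ring

theorem max_rpow_of_nonpos {x y r : ℝ} (hx : 0 < x) (hy : 0 < y) (hr : r ≤ 0) :
    max x y ^ r = min (x ^ r) (y ^ r) := by
  rcases le_total x y with h | h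
  · rw [max_eq_right h, min_eq_right (Real.rpow_le_rpow_of_nonpos hx h hr)]
  · rw [max_eq_left h, min_eq_left (Real.rpow_le_rpow_of_nonpos hy h hr)]

theorem max_muT_sub_eq_rankMistreatment {α β p Z₁ Z₂ z : ℝ} (hα : 0 < α) (hβ : β ∈ Ioo (0:ℝ) 1)
    (hp : p ∈ Ioo (0:ℝ) 1) (hZ₁ : 0 < Z₁) (hZ : Z₁ < Z₂) (hz : 1 < z) :
    max (muT α β p Z₁ Z₂ z - z ^ (-α)) 0
      = rankMistreatment (β ^ α) p (Z₁ ^ (-α)) (Z₂ ^ (-α)) (z ^ (-α)) := by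
  have hz0 : 0 < z := one_pos.trans hz
  have hZ₂ : 0 < Z₂ := hZ₁.trans hZ
  have hb : 0 < β ^ α := Real.rpow_pos_of_pos hβ.1 α
  have hb1 : β ^ α < 1 := Real.rpow_lt_one hβ.1.le hβ.2 hα
  have hu : 0 < z ^ (-α) := Real.rpow_pos_of_pos hz0 _
  have hu1 : z ^ (-α) < 1 := Real.rpow_lt_one_of_one_lt_of_neg hz (by linarith)
  have hα' : -α < 0 := by linarith
  have e1 : (β * z) ^ (-α) = z ^ (-α) / β ^ α := by
    rw [Real.mul_rpow hβ.1.le hz0.le, Real.rpow_neg hβ.1.le]; field_simp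
  have e2 : (z / β) ^ (-α) = z ^ (-α) * β ^ α := by
    rw [Real.div_rpow hz0.le hβ.1.le, Real.rpow_neg hβ.1.le, div_inv_eq_mul]
  have hgap : 0 ≤ (1 - p) * (min 1 (z ^ (-α) / β ^ α) - z ^ (-α)) := by
    refine mul_nonneg (by linarith [hp.2]) (sub_nonneg.2 (le_min hu1.le ?_))
    rw [le_div_iff₀ hb]
    nlinarith
  simp only [muT, Fbar, rankMistreatment]
  rw [max_rpow_of_nonpos (div_pos hz0 hβ.1) hZ₂ hα'.le,
    max_rpow_of_nonpos (mul_pos hβ.1 hz0) hZ₁ hα'.le, e1, e2]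
  have c1 : Z₁ ^ (-α) < z ^ (-α) ↔ z < Z₁ := Real.rpow_lt_rpow_iff_of_neg hZ₁ hz0 hα'
  have c2 : Z₂ ^ (-α) ≤ z ^ (-α) ↔ z ≤ Z₂ := Real.rpow_le_rpow_iff_of_neg hZ₂ hz0 hα'
  rw [if_congr c1 rfl rfl, if_congr c2 rfl rfl]
  split_ifs with h1 h2
  · rw [max_eq_left] <;> linarith
  · apply max_eq_right
    have := min_le_right (z ^ (-α) * β ^ α) (Z₂ ^ (-α))
    nlinarith [mul_le_mul_of_nonneg_left this hp.1.le]
  · have := mul_nonneg hp.1.le (le_max_left 0 (min (z ^ (-α) / β ^ α) (Z₁ ^ (-α)) - Z₂ ^ (-α)))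
    rw [max_eq_left] <;> linarith

theorem integral_comp_rpow_neg_Ioi_one {α : ℝ} (hα : 0 < α) (h : ℝ → ℝ) :
    ∫ z in Ioi (1:ℝ), h (z ^ (-α)) * (α * z ^ (-α - 1)) = ∫ u in (0:ℝ)..1, h u := by
  have key := integral_comp_rpow_Ioi ((Iio (1:ℝ)).indicator h) (p := -α) (by linarith)
  rw [abs_neg, abs_of_pos hα, setIntegral_indicator measurableSet_Iio, Ioi_inter_Iio,
    ← integral_Ioc_eq_integral_Ioo, ← intervalIntegral.integral_of_le zero_le_one] at key
  rw [← key]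
  have : ∀ z ∈ Ioi (0:ℝ), (α * z ^ (-α - 1)) • (Iio (1:ℝ)).indicator h (z ^ (-α))
      = (Ioi (1:ℝ)).indicator (fun z => h (z ^ (-α)) * (α * z ^ (-α - 1))) z := by
    intro z hz
    have c : z ^ (-α) < 1 ↔ 1 < z := by
      simpa using Real.rpow_lt_rpow_iff_of_neg hz one_pos (neg_lt_zero.2 hα)
    by_cases h1 : 1 < z
    · rw [indicator_of_mem (mem_Iio.2 (c.2 h1)), indicator_of_mem (mem_Ioi.2 h1), smul_eq_mul,
        mul_comm]
    · rw [indicator_of_notMem (mt c.1 h1 : z ^ (-α) ∉ Iio 1),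
        indicator_of_notMem (mt mem_Ioi.1 h1), smul_zero]
  rw [setIntegral_congr_fun measurableSet_Ioi this, setIntegral_indicator measurableSet_Ioi,
    inter_eq_right.2 (Ioi_subset_Ioi zero_le_one)]

theorem pauc_eq_rankPauc {α β p Z₁ Z₂ : ℝ} (hα : 0 < α) (hβ : β ∈ Ioo (0:ℝ) 1)
    (hp : p ∈ Ioo (0:ℝ) 1) (hZ₁ : 1 ≤ Z₁) (hZ : Z₁ < Z₂) :
    pauc α β p Z₁ Z₂ = rankPauc (β ^ α) p (Z₁ ^ (-α)) (Z₂ ^ (-α)) := by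
  have hZ0 : 0 < Z₁ := one_pos.trans_le hZ₁
  have hα' : -α ≤ 0 := by linarith
  rw [← integral_rankMistreatment (Real.rpow_pos_of_pos hβ.1 α)
    (Real.rpow_lt_one hβ.1.le hβ.2 hα).le (Real.rpow_nonneg (hZ0.trans hZ).le _)
    (Real.rpow_le_rpow_of_nonpos hZ0 hZ.le hα') (Real.rpow_le_one_of_one_le_of_nonpos hZ₁ hα'),
    ← integral_comp_rpow_neg_Ioi_one hα, pauc]
  refine setIntegral_congr_fun measurableSet_Ioi fun z hz => ?_
  simp only [max_muT_sub_eq_rankMistreatment hα hβ hp hZ0 hZ hz]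

/-- Optimal voucher interval minimizing the PAUC, large-budget case
`ĉ ≥ (1-p)(1-β^α)/(2-p-β^α-pβ^α+pβ^{2α})`. -/
theorem optimal_range_pauc_large_budget (α β p c : ℝ) (hα : 0 < α)
    (hβ : β ∈ Ioo (0:ℝ) 1) (hp : p ∈ Ioo (0:ℝ) 1)
    (hpβ : p < 1 - β ^ α) (hphalf : p < 1 / 2)
    (hc : (1 - p) * (1 - β ^ α)
        / (2 - p - β ^ α - p * β ^ α + p * β ^ (2 * α)) ≤ c) (hc1 : c < 1) :
    1 ≤ ((1 - p) * (1 - c) / (p * β ^ α + β ^ (-α) - 2 * p) + c) ^ (-1 / α) ∧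
    ((1 - p) * (1 - c) / (p * β ^ α + β ^ (-α) - 2 * p) + c) ^ (-1 / α)
      < ((1 - p) * (1 - c) / (p * β ^ α + β ^ (-α) - 2 * p)) ^ (-1 / α) ∧
    pauc α β p
        (((1 - p) * (1 - c) / (p * β ^ α + β ^ (-α) - 2 * p) + c) ^ (-1 / α))
        (((1 - p) * (1 - c) / (p * β ^ α + β ^ (-α) - 2 * p)) ^ (-1 / α))
      = (1 / 2) * ((1 - p) * (1 - β ^ α)) * ((β ^ (-α) - p) * (1 - c) ^ 2)
          / (p * β ^ α + β ^ (-α) - 2 * p) ∧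
    ∀ Z₁ Z₂ : ℝ, 1 ≤ Z₁ → Z₁ < Z₂ → Z₁ ^ (-α) - Z₂ ^ (-α) ≤ c →
      pauc α β p
          (((1 - p) * (1 - c) / (p * β ^ α + β ^ (-α) - 2 * p) + c) ^ (-1 / α))
          (((1 - p) * (1 - c) / (p * β ^ α + β ^ (-α) - 2 * p)) ^ (-1 / α))
        ≤ pauc α β p Z₁ Z₂ := by
  have hb : 0 < β ^ α := Real.rpow_pos_of_pos hβ.1 α
  have hb1 : β ^ α < 1 := Real.rpow_lt_one hβ.1.le hβ.2 hα
  have hinv : β ^ (-α) = (β ^ α)⁻¹ := Real.rpow_neg hβ.1.le α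
  have hsq : β ^ (2 * α) = (β ^ α) ^ 2 := by
    simpa [mul_comm] using Real.rpow_mul_natCast hβ.1.le α 2
  rw [hinv]
  rw [hsq] at hc
  have hbudget : (1 - p) * (1 - β ^ α)
      ≤ c * (2 - p - β ^ α - p * β ^ α + p * (β ^ α) ^ 2) := by
    rwa [div_le_iff₀ (by nlinarith [mul_pos hp.1 hb, mul_pos hb hb])] at hc
  have hc0 : 0 < c := lt_of_lt_of_le (mul_pos hb (by linarith))
    (mul_one_sub_le_of_budget hb hb1 hp.1 hpβ hbudget)
  have hd : 0 < (1 - p) * (1 - c) / (p * β ^ α + (β ^ α)⁻¹ - 2 * p) :=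
    div_pos (mul_pos (by linarith [hp.2]) (by linarith)) (optimum_denom_pos hb hb1 hp.1 hphalf)
  have ha1 := optimum_upper_le_one hb hb1 hp.1 hphalf hc1
  have hopt := rankPauc_optimum hb hb1 hp.1 hphalf hpβ hbudget hc1
  set d := (1 - p) * (1 - c) / (p * β ^ α + (β ^ α)⁻¹ - 2 * p)
  have hneg : -1 / α < 0 := div_neg_of_neg_of_pos (by norm_num) hα
  have hZ₁ : 1 ≤ (d + c) ^ (-1 / α) :=
    Real.one_le_rpow_of_pos_of_le_one_of_nonpos (by linarith) ha1 hneg.le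
  have hZ : (d + c) ^ (-1 / α) < d ^ (-1 / α) := Real.rpow_lt_rpow_of_neg hd (by linarith) hneg
  have hcancel : ∀ x : ℝ, 0 < x → (x ^ (-1 / α)) ^ (-α) = x := by
    intro x hx
    rw [← Real.rpow_mul hx.le, show -1 / α * -α = 1 by field_simp, Real.rpow_one]
  have hval := pauc_eq_rankPauc hα hβ hp hZ₁ hZ
  rw [hcancel _ hd, hcancel _ (by linarith), hopt] at hval
  refine ⟨hZ₁, hZ, hval, fun Z₁ Z₂ h1 h2 h3 => ?_⟩
  have h0 : 0 < Z₁ := one_pos.trans_le h1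
  rw [hval, pauc_eq_rankPauc hα hβ hp h1 h2]
  exact optimum_le_rankPauc hb hb1 hp.1 hphalf hpβ hbudget hc1
    (Real.rpow_nonneg (h0.trans h2).le _) (Real.rpow_le_rpow_of_nonpos h0 h2.le (by linarith))
    (Real.rpow_le_one_of_one_le_of_nonpos h1 (by linarith)) h3
end

section
/- Assume p < 1 − β^α and p < 1/2, and let ĉ satisfy 0 < ĉ ≤ c₀ where c₀ = (1−p)(1−β^α)/(2−p−β^α−p·β^α+p·β^{2α}). Set Z₂* = (β^α·((p·β^α−1)·ĉ+(1−p))/(1−p))^{−1/α} and Z₁* = (β^α·((p·β^α−1)·ĉ+(1−p))/(1−p) + ĉ)^{−1/α}. Then 1 ≤ Z₁* < Z₂*, σ([Z₁*,Z₂*]) = (1/2)·(1−p)(1−ĉ)² − (1/2)·β^α·(((p·β^α−1)·ĉ+(1−p))²/(1−p) + p·ĉ²), and for every interval [Z₁,Z₂] with 1 ≤ Z₁ < Z₂ and Z₁^{−α} − Z₂^{−α} ≤ ĉ one has σ([Z₁,Z₂]) ≥ σ([Z₁*,Z₂*]). -/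
open MeasureTheory

open Set

lemma hasDerivAt_max_zero_sq (x : ℝ) : HasDerivAt (fun y : ℝ => max y 0 ^ 2) (2 * max x 0) x := by
  rcases lt_trichotomy x 0 with h | rfl | h
  · rw [max_eq_right h.le, mul_zero]
    refine (hasDerivAt_const x (0 : ℝ)).congr_of_eventuallyEq ?_
    filter_upwards [Iio_mem_nhds h] with y hy
    simp [max_eq_right (le_of_lt (mem_Iio.1 hy))]
  · rw [max_self, mul_zero, hasDerivAt_iff_isLittleO_nhds_zero]
    refine Asymptotics.IsBigO.trans_isLittleO (g := fun h : ℝ => h ^ 2) ?_ ?_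
    · refine Asymptotics.IsBigO.of_bound 1 (Filter.Eventually.of_forall fun h => ?_)
      simp only [zero_add, max_self, smul_zero, Real.norm_eq_abs, one_mul]
      rcases le_total h 0 with h0 | h0 <;> simp [h0, sq_nonneg]
    · exact Asymptotics.isLittleO_pow_id one_lt_two
  · rw [max_eq_left h.le]
    have := (hasDerivAt_pow 2 x).congr_of_eventuallyEq (f₁ := fun y : ℝ => max y 0 ^ 2) ?_
    · simpa using this
    · filter_upwards [Ioi_mem_nhds h] with y hy
      simp [max_eq_left (le_of_lt (mem_Ioi.1 hy))]

lemma integral_max_div_sub_zero {b : ℝ} (hb : b ≠ 0) (w x y : ℝ) :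
    ∫ s in x..y, max (s / b - w) 0
      = b / 2 * (max (y / b - w) 0 ^ 2 - max (x / b - w) 0 ^ 2) := by
  rw [mul_sub]
  refine intervalIntegral.integral_eq_sub_of_hasDerivAt
    (f := fun s => b / 2 * max (s / b - w) 0 ^ 2) (fun s _ => ?_)
    (Continuous.intervalIntegrable (by fun_prop) _ _)
  have h := ((hasDerivAt_max_zero_sq (s / b - w)).comp s
    (((hasDerivAt_id s).div_const b).sub_const w)).const_mul (b / 2)
  refine h.congr_deriv ?_
  field_simp

lemma integral_pareto_comp {α : ℝ} (hα : 0 < α) (f : ℝ → ℝ) :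
    ∫ z in Ioi (1 : ℝ), f (z ^ (-α)) * (α * z ^ (-α - 1)) = ∫ s in (0 : ℝ)..1, f s := by
  have h := integral_comp_rpow_Ioi ((Iio (1 : ℝ)).indicator f) (neg_ne_zero.2 hα.ne')
  rw [intervalIntegral.integral_of_le zero_le_one, integral_Ioc_eq_integral_Ioo,
    ← Ioi_inter_Iio, ← setIntegral_indicator measurableSet_Iio, ← h,
    ← inter_eq_self_of_subset_right (Ioi_subset_Ioi (zero_le_one' ℝ)),
    ← setIntegral_indicator measurableSet_Ioi]
  refine setIntegral_congr_fun measurableSet_Ioi fun z hz => ?_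
  have hz0 : 0 < z := hz
  by_cases hz1 : 1 < z
  · have : z ^ (-α) < 1 := Real.rpow_lt_one_of_one_lt_of_neg hz1 (neg_lt_zero.2 hα)
    simp only [indicator, mem_Ioi, hz1, mem_Iio, this, if_true, abs_neg, abs_of_pos hα, smul_eq_mul]
    ring
  · have : ¬ z ^ (-α) < 1 := not_lt.2
      (Real.one_le_rpow_of_pos_of_le_one_of_nonpos hz0 (not_lt.1 hz1) (neg_nonpos.2 hα.le))
    simp [indicator, hz1, this]

/-- Antiderivative of `s ↦ min 1 (s / b) - s` vanishing at `0`. -/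
noncomputable def displacementArea (b x : ℝ) : ℝ :=
  (x ^ 2 / b - b * max (x / b - 1) 0 ^ 2 - x ^ 2) / 2

lemma integral_min_one_div_sub {b : ℝ} (hb : 0 < b) (x y : ℝ) :
    ∫ s in x..y, (min 1 (s / b) - s) = displacementArea b y - displacementArea b x := by
  have h : ∀ s : ℝ, min 1 (s / b) - s = (1 / b - 1) * s - max (s / b - 1) 0 := fun s => by
    rcases le_total 1 (s / b) with h | h
    · rw [min_eq_left h, max_eq_left (by linarith)]; ring
    · rw [min_eq_right h, max_eq_right (by linarith)]; ring
  simp only [h]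
  rw [intervalIntegral.integral_sub (Continuous.intervalIntegrable (by fun_prop) _ _)
    (Continuous.intervalIntegrable (by fun_prop) _ _), integral_max_div_sub_zero hb.ne',
    intervalIntegral.integral_const_mul, integral_id, displacementArea, displacementArea]
  ring

/-- The mistreatment of a G₂ student whose unbiased school is `s`, when the debiased students
are those with unbiased school in `[v, u]`, and `b = β ^ α`. -/
noncomputable def mistreatment (b p u v s : ℝ) : ℝ :=
  if u < s then (1 - p) * (min 1 (s / b) - s)
  else if v ≤ s then 0
  else (1 - p) * (min 1 (s / b) - s) + p * (max (s / b - v) 0 - max (s / b - u) 0)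

lemma rpow_neg_max {α x y : ℝ} (hα : 0 < α) (hx : 0 < x) (hy : 0 < y) :
    max x y ^ (-α) = min (x ^ (-α)) (y ^ (-α)) := by
  rcases le_total x y with h | h
  · rw [max_eq_right h, min_eq_right (Real.rpow_le_rpow_of_nonpos hx h (by linarith))]
  · rw [max_eq_left h, min_eq_left (Real.rpow_le_rpow_of_nonpos hy h (by linarith))]

lemma max_muT_sub_eq_mistreatment {α β p Z₁ Z₂ z : ℝ} (hα : 0 < α) (hβ : β ∈ Ioo (0 : ℝ) 1)
    (hp : p ∈ Ioo (0 : ℝ) 1) (h₁ : 1 ≤ Z₁) (h₁₂ : Z₁ < Z₂) (hz : 1 < z) :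
    max (muT α β p Z₁ Z₂ z - z ^ (-α)) 0
      = mistreatment (β ^ α) p (Z₁ ^ (-α)) (Z₂ ^ (-α)) (z ^ (-α)) := by
  have hz0 : 0 < z := by linarith
  have hZ₁ : 0 < Z₁ := by linarith
  have hZ₂ : 0 < Z₂ := by linarith
  have hb0 : 0 < β ^ α := Real.rpow_pos_of_pos hβ.1 _
  have hb1 : β ^ α < 1 := Real.rpow_lt_one hβ.1.le hβ.2 hα
  have hs0 : 0 < z ^ (-α) := Real.rpow_pos_of_pos hz0 _
  have hs1 : z ^ (-α) < 1 := Real.rpow_lt_one_of_one_lt_of_neg hz (by linarith)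
  have hvu : Z₂ ^ (-α) < Z₁ ^ (-α) := Real.rpow_lt_rpow_of_neg hZ₁ h₁₂ (by linarith)
  have hzu : z < Z₁ ↔ Z₁ ^ (-α) < z ^ (-α) :=
    (Real.rpow_lt_rpow_iff_of_neg hZ₁ hz0 (by linarith)).symm
  have hzv : z ≤ Z₂ ↔ Z₂ ^ (-α) ≤ z ^ (-α) :=
    (Real.rpow_le_rpow_iff_of_neg hZ₂ hz0 (by linarith)).symm
  have hmul : (β * z) ^ (-α) = z ^ (-α) / β ^ α := by
    rw [Real.mul_rpow hβ.1.le hz0.le, Real.rpow_neg hβ.1.le, div_eq_inv_mul]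
  have hdiv : (z / β) ^ (-α) = β ^ α * z ^ (-α) := by
    rw [Real.div_rpow hz0.le hβ.1.le, Real.rpow_neg hβ.1.le, div_inv_eq_mul, mul_comm]
  have hsb : z ^ (-α) ≤ z ^ (-α) / β ^ α := by
    rw [le_div_iff₀ hb0]; nlinarith
  have hmin : 0 ≤ min 1 (z ^ (-α) / β ^ α) - z ^ (-α) :=
    sub_nonneg.2 (le_min hs1.le hsb)
  have hp1 : 0 ≤ 1 - p := by linarith [hp.2]
  simp only [muT, Fbar, mistreatment, rpow_neg_max hα (mul_pos hβ.1 hz0) hZ₁,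
    rpow_neg_max hα (div_pos hz0 hβ.1) hZ₂, hmul, hdiv, hzu, hzv]
  generalize z ^ (-α) = s at *
  generalize Z₁ ^ (-α) = u at *
  generalize Z₂ ^ (-α) = v at *
  generalize β ^ α = b at *
  split_ifs
  · rw [max_eq_left] <;> nlinarith
  · apply max_eq_right
    have : min (b * s) v ≤ v := min_le_right _ _
    nlinarith [hp.1]
  · have h : max 0 (min (s / b) u - v) = max (s / b - v) 0 - max (s / b - u) 0 := by
      rcases le_total (s / b) u with h | h
      · rw [min_eq_left h, max_eq_right (by linarith : s / b - u ≤ 0), sub_zero, max_comm]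
      · rw [min_eq_right h, max_eq_right (by linarith), max_eq_left (by linarith),
          max_eq_left (by linarith)]
        ring
    rw [← h, max_eq_left]
    · ring
    · have := mul_nonneg hp.1.le (le_max_left 0 (min (s / b) u - v))
      nlinarith

lemma integral_mistreatment {b p u v : ℝ} (hb0 : 0 < b) (hb1 : b < 1) (hv : 0 < v)
    (hvu : v < u) (hu : u ≤ 1) :
    ∫ s in (0 : ℝ)..1, mistreatment b p u v s
      = (1 - p) * ((1 - b) / 2 - displacementArea b u + displacementArea b v)
        + p * (b / 2) * ((v / b - v) ^ 2 - max (v / b - u) 0 ^ 2) := by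
  have e₁ : EqOn (fun s => (1 - p) * (min 1 (s / b) - s)
      + p * (max (s / b - v) 0 - max (s / b - u) 0)) (mistreatment b p u v) (uIoo 0 v) := by
    rw [uIoo_of_le hv.le]
    intro s hs
    simp [mistreatment, not_lt.2 (hs.2.trans hvu).le, not_le.2 hs.2]
  have e₂ : EqOn (fun _ => (0 : ℝ)) (mistreatment b p u v) (uIoo v u) := by
    rw [uIoo_of_le hvu.le]
    intro s hs
    simp [mistreatment, not_lt.2 hs.2.le, hs.1.le]
  have e₃ : EqOn (fun s => (1 - p) * (min 1 (s / b) - s)) (mistreatment b p u v) (uIoo u 1) := by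
    rw [uIoo_of_le hu]
    intro s hs
    simp [mistreatment, hs.1]
  have i₁ := IntervalIntegrable.congr_uIoo (μ := volume)
    (Continuous.intervalIntegrable (by fun_prop) 0 v) e₁
  have i₂ := IntervalIntegrable.congr_uIoo (μ := volume)
    (Continuous.intervalIntegrable (by fun_prop) v u) e₂
  have i₃ := IntervalIntegrable.congr_uIoo (μ := volume)
    (Continuous.intervalIntegrable (by fun_prop) u 1) e₃
  rw [← intervalIntegral.integral_add_adjacent_intervals (i₁.trans i₂) i₃,
    ← intervalIntegral.integral_add_adjacent_intervals i₁ i₂,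
    ← intervalIntegral.integral_congr_uIoo e₁, ← intervalIntegral.integral_congr_uIoo e₂,
    ← intervalIntegral.integral_congr_uIoo e₃,
    intervalIntegral.integral_add (Continuous.intervalIntegrable (by fun_prop) _ _)
      (Continuous.intervalIntegrable (by fun_prop) _ _),
    intervalIntegral.integral_const_mul, intervalIntegral.integral_const_mul,
    intervalIntegral.integral_const_mul, integral_min_one_div_sub hb0,
    integral_min_one_div_sub hb0,
    intervalIntegral.integral_sub (Continuous.intervalIntegrable (by fun_prop) _ _)
      (Continuous.intervalIntegrable (by fun_prop) _ _),
    integral_max_div_sub_zero hb0.ne', integral_max_div_sub_zero hb0.ne',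
    intervalIntegral.integral_zero]
  have hvb : 0 ≤ v / b - v := by
    rw [sub_nonneg, le_div_iff₀ hb0]; nlinarith
  have h1b : 0 ≤ 1 / b - 1 := by
    rw [sub_nonneg, le_div_iff₀ hb0]; linarith
  rw [max_eq_left hvb, max_eq_right (by simpa using hv.le : 0 / b - v ≤ 0),
    max_eq_right (by simpa using (hv.trans hvu).le : 0 / b - u ≤ 0)]
  have d₀ : displacementArea b 0 = 0 := by simp [displacementArea]
  have d₁ : displacementArea b 1 = (1 - b) / 2 := by
    rw [displacementArea, max_eq_left h1b]
    field_simp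
    ring
  rw [d₀, d₁]
  ring

lemma pauc_eq {α β p Z₁ Z₂ : ℝ} (hα : 0 < α) (hβ : β ∈ Ioo (0 : ℝ) 1)
    (hp : p ∈ Ioo (0 : ℝ) 1) (h₁ : 1 ≤ Z₁) (h₁₂ : Z₁ < Z₂) :
    pauc α β p Z₁ Z₂
      = (1 - p) * ((1 - β ^ α) / 2 - displacementArea (β ^ α) (Z₁ ^ (-α))
          + displacementArea (β ^ α) (Z₂ ^ (-α)))
        + p * (β ^ α / 2) * ((Z₂ ^ (-α) / β ^ α - Z₂ ^ (-α)) ^ 2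
          - max (Z₂ ^ (-α) / β ^ α - Z₁ ^ (-α)) 0 ^ 2) := by
  have hZ₁ : 0 < Z₁ := by linarith
  rw [← integral_mistreatment (Real.rpow_pos_of_pos hβ.1 _) (Real.rpow_lt_one hβ.1.le hβ.2 hα)
    (Real.rpow_pos_of_pos (hZ₁.trans h₁₂) _)
    (Real.rpow_lt_rpow_of_neg hZ₁ h₁₂ (by linarith))
    (Real.rpow_le_one_of_one_le_of_nonpos h₁ (by linarith)), ← integral_pareto_comp hα, pauc]
  refine setIntegral_congr_fun measurableSet_Ioi fun z hz => ?_
  simp only [max_muT_sub_eq_mistreatment hα hβ hp h₁ h₁₂ hz]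

lemma displacementArea_mul_of_le_one {b w : ℝ} (hb : 0 < b) (hw : w ≤ 1) :
    displacementArea b (b * w) = (b * w ^ 2 - b ^ 2 * w ^ 2) / 2 := by
  rw [displacementArea, mul_div_cancel_left₀ _ hb.ne', max_eq_right (by linarith)]
  field_simp
  ring

lemma displacementArea_of_le {b x : ℝ} (hb : 0 < b) (hx : b ≤ x) :
    displacementArea b x = x - b / 2 - x ^ 2 / 2 := by
  rw [displacementArea, max_eq_left (by rw [sub_nonneg, le_div_iff₀ hb]; linarith)]
  field_simp
  ring

/-- The optimal average mistreatment when exactly a mass `d` of students is debiased, where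
`b = β ^ α` and `k = (1 - p * b) / (1 - p)`. -/
noncomputable def optimalPauc (b p k d : ℝ) : ℝ :=
  (1 - p) * (1 - d) ^ 2 / 2 - b / 2 * ((1 - p) * (1 - k * d) ^ 2 + p * d ^ 2)

lemma optimalPauc_le_of_le {b p k c d : ℝ} (hb0 : 0 < b) (hb1 : b < 1) (hp0 : 0 < p)
    (hp : p < 1 / 2) (hpb : p < 1 - b) (hk : k * (1 - p) = 1 - p * b) (hd : 0 < d)
    (hdc : d ≤ c) (hc : c * (1 + k * (1 - b)) ≤ 1 - b) :
    optimalPauc b p k c ≤ optimalPauc b p k d := by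
  have hk0 : 0 < k := by
    by_contra! h
    nlinarith
  have hpos : 0 ≤ (1 - p) - b * (1 - p * b) := by
    nlinarith [mul_pos hp0 (mul_pos hb0 hb0)]
  have hu : b * (1 - k * c) + c ≤ 1 := by
    nlinarith [mul_pos hk0 (hd.trans_le hdc)]
  have hkc : 0 < k * c := mul_pos hk0 (hd.trans_le hdc)
  have hend : 0 ≤ (1 - p) * (1 - c) - b * (1 - p * b) * (1 - k * c) + b * p * c := by
    have h₁ : 0 ≤ (1 - p - p * b) * (1 - (b * (1 - k * c) + c)) :=
      mul_nonneg (by nlinarith) (by linarith)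
    have h₂ : 0 ≤ p * (b * (k * c)) := by positivity
    nlinarith
  have hc0 : 0 < c := hd.trans_le hdc
  have key : 0 ≤ (1 - p) * (2 - (c + d)) - b * (1 - p * b) * (2 - k * (c + d))
      + b * p * (c + d) := by
    have h : 0 ≤ c * ((1 - p) * (2 - (c + d)) - b * (1 - p * b) * (2 - k * (c + d))
        + b * p * (c + d)) := by
      nlinarith [mul_nonneg (sub_nonneg.2 hdc) hpos, mul_nonneg (by linarith : 0 ≤ c + d) hend]
    exact nonneg_of_mul_nonneg_right h hc0
  have hdiff : optimalPauc b p k d - optimalPauc b p k c = (c - d) / 2 *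
      ((1 - p) * (2 - (c + d)) - b * (1 - p * b) * (2 - k * (c + d)) + b * p * (c + d)) := by
    rw [optimalPauc, optimalPauc, ← hk]
    ring
  have := mul_nonneg (by linarith : 0 ≤ (c - d) / 2) key
  linarith

lemma optimalPauc_sub_le {b p k u w : ℝ} (hb0 : 0 < b) (hb1 : b < 1) (hp0 : 0 < p)
    (hp : p < 1 / 2) (hk : k * (1 - p) = 1 - p * b) (hw : 0 < w) (hwu : b * w < u)
    (hu : u ≤ 1) :
    optimalPauc b p k (u - b * w)
      ≤ (1 - p) * ((1 - b) / 2 - displacementArea b u + displacementArea b (b * w))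
        + p * (b / 2) * ((w - b * w) ^ 2 - max (w - u) 0 ^ 2) := by
  have hmax : max (w - u) 0 ^ 2 ≤ (w - u) ^ 2 := by
    rcases le_total (w - u) 0 with h | h
    · simp [h, sq_nonneg]
    · simp [h]
  have hH : p * (b / 2) * ((w - b * w) ^ 2 - (w - u) ^ 2)
      ≤ p * (b / 2) * ((w - b * w) ^ 2 - max (w - u) 0 ^ 2) :=
    mul_le_mul_of_nonneg_left (by linarith) (by positivity)
  refine le_trans ?_ (add_le_add_right hH _)
  obtain ⟨d, rfl⟩ : ∃ d, u = b * w + d := ⟨u - b * w, by ring⟩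
  have hd : 0 < d := by linarith
  have hquad : ∀ w : ℝ, optimalPauc b p k d
      ≤ (1 - p) * ((1 - b) / 2 - (b * w + d - b / 2 - (b * w + d) ^ 2 / 2)
          + (b * w ^ 2 - b ^ 2 * w ^ 2) / 2)
        + p * (b / 2) * ((w - b * w) ^ 2 - (w - (b * w + d)) ^ 2) := fun w => by
    have h : 0 ≤ (1 - p) * b / 2 * (w - (1 - k * d)) ^ 2 :=
      mul_nonneg (by nlinarith) (sq_nonneg _)
    have hkd : k * (1 - p) * (b * d * w) = (1 - p * b) * (b * d * w) := by rw [hk]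
    rw [optimalPauc]
    linarith
  rw [add_sub_cancel_left]
  rcases le_total w 1 with hw1 | hw1
  · rw [displacementArea_mul_of_le_one hb0 hw1]
    rcases le_total b (b * w + d) with hbu | hbu
    · rw [displacementArea_of_le hb0 hbu]
      exact hquad w
    · refine (hquad (1 - d / b)).trans ?_
      have hx : b * w + d = b * (w + d / b) := by field_simp
      obtain ⟨e, rfl⟩ : ∃ e, d = b * e := ⟨d / b, by field_simp⟩
      rw [hx, mul_div_cancel_left₀ _ hb0.ne', displacementArea_mul_of_le_one hb0 (by nlinarith)]
      have he : 0 < e := by nlinarith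
      have hwe : w + e ≤ 1 := by nlinarith
      have h : 0 ≤ b * e * (1 - b) * ((1 - p) - p * b) * (1 - e - w) := by
        have : 0 ≤ 1 - p - p * b := by nlinarith
        have : 0 ≤ 1 - e - w := by linarith
        have : 0 ≤ 1 - b := by linarith
        positivity
      linarith
  · rw [displacementArea_of_le hb0 (by nlinarith), displacementArea_of_le hb0 (by nlinarith)]
    refine (hquad 1).trans ?_
    have h : 0 ≤ b * d * ((1 - p) + p * (1 - b)) * (w - 1) := by
      have : 0 ≤ (1 - p) + p * (1 - b) := by nlinarith
      have : 0 ≤ w - 1 := by linarith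
      positivity
    linarith

lemma pauc_optimal_eq {b p k c : ℝ} (hb0 : 0 < b) (hkc : 0 ≤ k * c)
    (hk : k * (1 - p) = 1 - p * b) (hbu : b ≤ b * (1 - k * c) + c)
    (huv : b * (1 - k * c) + c ≤ 1 - k * c) :
    (1 - p) * ((1 - b) / 2 - displacementArea b (b * (1 - k * c) + c)
        + displacementArea b (b * (1 - k * c)))
      + p * (b / 2) * (((1 - k * c) - b * (1 - k * c)) ^ 2
        - max ((1 - k * c) - (b * (1 - k * c) + c)) 0 ^ 2) = optimalPauc b p k c := by
  rw [displacementArea_of_le hb0 hbu, displacementArea_mul_of_le_one hb0 (by linarith),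
    max_eq_left (by linarith), optimalPauc]
  have hkd : k * (1 - p) * (b * c * (1 - k * c)) = (1 - p * b) * (b * c * (1 - k * c)) := by rw [hk]
  linarith

lemma rpow_neg_one_div_rpow_neg {α x : ℝ} (hα : α ≠ 0) (hx : 0 ≤ x) :
    (x ^ (-1 / α)) ^ (-α) = x := by
  rw [← Real.rpow_mul hx, show -1 / α * -α = 1 by field_simp, Real.rpow_one]

/-- Optimal voucher interval minimizing the PAUC, small-budget case
`ĉ ≤ (1-p)(1-β^α)/(2-p-β^α-pβ^α+pβ^{2α})`. -/
theorem optimal_range_pauc_small_budget (α β p c : ℝ) (hα : 0 < α)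
    (hβ : β ∈ Ioo (0:ℝ) 1) (hp : p ∈ Ioo (0:ℝ) 1)
    (hpβ : p < 1 - β ^ α) (hphalf : p < 1 / 2) (hc0 : 0 < c)
    (hc : c ≤ (1 - p) * (1 - β ^ α)
        / (2 - p - β ^ α - p * β ^ α + p * β ^ (2 * α))) :
    1 ≤ (β ^ α * ((p * β ^ α - 1) * c + (1 - p)) / (1 - p) + c) ^ (-1 / α) ∧
    (β ^ α * ((p * β ^ α - 1) * c + (1 - p)) / (1 - p) + c) ^ (-1 / α)
      < (β ^ α * ((p * β ^ α - 1) * c + (1 - p)) / (1 - p)) ^ (-1 / α) ∧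
    pauc α β p
        ((β ^ α * ((p * β ^ α - 1) * c + (1 - p)) / (1 - p) + c) ^ (-1 / α))
        ((β ^ α * ((p * β ^ α - 1) * c + (1 - p)) / (1 - p)) ^ (-1 / α))
      = (1 / 2) * (1 - p) * (1 - c) ^ 2
        - (1 / 2) * β ^ α
          * (((p * β ^ α - 1) * c + (1 - p)) ^ 2 / (1 - p) + p * c ^ 2) ∧
    ∀ Z₁ Z₂ : ℝ, 1 ≤ Z₁ → Z₁ < Z₂ → Z₁ ^ (-α) - Z₂ ^ (-α) ≤ c →
      pauc α β p
          ((β ^ α * ((p * β ^ α - 1) * c + (1 - p)) / (1 - p) + c) ^ (-1 / α))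
          ((β ^ α * ((p * β ^ α - 1) * c + (1 - p)) / (1 - p)) ^ (-1 / α))
        ≤ pauc α β p Z₁ Z₂ := by
  have hb0 : 0 < β ^ α := Real.rpow_pos_of_pos hβ.1 _
  have hb1 : β ^ α < 1 := Real.rpow_lt_one hβ.1.le hβ.2 hα
  have hsq : β ^ (2 * α) = (β ^ α) ^ 2 := by
    rw [mul_comm, Real.rpow_mul hβ.1.le, Real.rpow_two]
  rw [hsq] at hc
  have hlb : ∀ k : ℝ, k * (1 - p) = 1 - p * β ^ α → ∀ Z₁ Z₂ : ℝ, 1 ≤ Z₁ → Z₁ < Z₂ →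
      optimalPauc (β ^ α) p k (Z₁ ^ (-α) - Z₂ ^ (-α)) ≤ pauc α β p Z₁ Z₂ := by
    intro k hk Z₁ Z₂ h₁ h₁₂
    have hZ₁ : 0 < Z₁ := by linarith
    have hv : Z₂ ^ (-α) = β ^ α * (Z₂ ^ (-α) / β ^ α) := by field_simp
    have hvu : Z₂ ^ (-α) < Z₁ ^ (-α) := Real.rpow_lt_rpow_of_neg hZ₁ h₁₂ (by linarith)
    have h := optimalPauc_sub_le hb0 hb1 hp.1 hphalf hk
      (div_pos (Real.rpow_pos_of_pos (hZ₁.trans h₁₂) (-α)) hb0) (hv ▸ hvu)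
      (Real.rpow_le_one_of_one_le_of_nonpos h₁ (by linarith))
    rw [pauc_eq hα hβ hp h₁ h₁₂]
    rwa [← hv] at h
  have heq : ∀ Z₁ Z₂ : ℝ, 1 ≤ Z₁ → Z₁ < Z₂ → pauc α β p Z₁ Z₂ = _ :=
    fun Z₁ Z₂ => pauc_eq hα hβ hp
  have hmass : ∀ Z₁ Z₂ : ℝ, 1 ≤ Z₁ → Z₁ < Z₂ → 0 < Z₁ ^ (-α) - Z₂ ^ (-α) :=
    fun Z₁ Z₂ h₁ h₁₂ => sub_pos.2 (Real.rpow_lt_rpow_of_neg (by linarith) h₁₂ (by linarith))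
  generalize β ^ α = b at *
  have hp0 := hp.1
  have hq : 0 < 1 - p := by linarith
  have hpb1 : 0 < 1 - p * b := by nlinarith
  obtain ⟨k, hkdef⟩ : ∃ k, k = (1 - p * b) / (1 - p) := ⟨_, rfl⟩
  have hk : k * (1 - p) = 1 - p * b := by rw [hkdef]; field_simp
  have hk0 : 0 < k := by rw [hkdef]; positivity
  have hv : b * ((p * b - 1) * c + (1 - p)) / (1 - p) = b * (1 - k * c) := by
    rw [hkdef]; field_simp; ring
  have hval : (1 / 2) * (1 - p) * (1 - c) ^ 2
      - (1 / 2) * b * (((p * b - 1) * c + (1 - p)) ^ 2 / (1 - p) + p * c ^ 2)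
      = optimalPauc b p k c := by
    rw [optimalPauc, hkdef]; field_simp; ring
  have hc' : c * (1 + k * (1 - b)) ≤ 1 - b := by
    rw [le_div_iff₀ (by nlinarith [mul_pos hpb1 (sub_pos.2 hb1)])] at hc
    refine le_of_mul_le_mul_left ?_ hq
    have : k * (1 - p) * (c * (1 - b)) = (1 - p * b) * (c * (1 - b)) := by rw [hk]
    linarith
  have hkc : 0 < k * c := mul_pos hk0 hc0
  have huv : b * (1 - k * c) + c ≤ 1 - k * c := by linarith
  have hw : 0 < 1 - k * c := by nlinarith
  have hv0 : 0 < b * (1 - k * c) := mul_pos hb0 hw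
  have hbk : b * k ≤ 1 := by
    refine le_of_mul_le_mul_right ?_ hq
    have : 0 < p * (b * b) := by positivity
    nlinarith
  have hbu : b ≤ b * (1 - k * c) + c := by nlinarith
  have hexp : -1 / α < 0 := div_neg_of_neg_of_pos (by norm_num) hα
  rw [hv, hval]
  have h₁ : 1 ≤ (b * (1 - k * c) + c) ^ (-1 / α) :=
    Real.one_le_rpow_of_pos_of_le_one_of_nonpos (by linarith) (by linarith) hexp.le
  have h₁₂ : (b * (1 - k * c) + c) ^ (-1 / α) < (b * (1 - k * c)) ^ (-1 / α) :=
    Real.rpow_lt_rpow_of_neg hv0 (by linarith) hexp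
  have hopt : pauc α β p ((b * (1 - k * c) + c) ^ (-1 / α)) ((b * (1 - k * c)) ^ (-1 / α))
      = optimalPauc b p k c := by
    rw [heq _ _ h₁ h₁₂, rpow_neg_one_div_rpow_neg hα.ne' (by linarith),
      rpow_neg_one_div_rpow_neg hα.ne' hv0.le, mul_div_cancel_left₀ _ hb0.ne']
    exact pauc_optimal_eq hb0 hkc.le hk hbu huv
  refine ⟨h₁, h₁₂, hopt, fun Z₁ Z₂ hZ₁ hZ₁₂ hZ => ?_⟩
  rw [hopt]
  exact (optimalPauc_le_of_le hb0 hb1 hp0 hphalf hpβ hk (hmass Z₁ Z₂ hZ₁ hZ₁₂) hZ hc').trans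
    (hlb k hk Z₁ Z₂ hZ₁ hZ₁₂)
end
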